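/- arXiv:1308.4661 — 5 statements merged into one kernel-verified Lean document; each statement's English description precedes it below -/
import Mathlib

section
/- Let r ≥ 2 and 0 ≤ i ≤ r−1 be integers, with degree sequence e = e(i,r) and pure diagram entries β_p as above. Then in the polynomial ring ℚ[t], the polynomial (1−t)^{r−1} divides the K-polynomial Σ_{p=0}^{r−1} (−1)^p · β_p · t^{e_p} of the pure diagram π_{i,r}. -/
/-- The degree sequence `e(i,r)`: `e 0 = 0`, `e p = p + 1` for `1 ≤ p ≤ r - i - 1`,
and `e p = p + 2` for `r - i ≤ p ≤ r - 1`. -/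
def degSeq (r i p : ℕ) : ℕ :=
  if p = 0 then 0 else if p ≤ r - i - 1 then p + 1 else p + 2

/-- The entries of the pure diagram `π_{i,r}`:
`β_p = (r-1)! · ∏_{ℓ ≠ p} 1 / |e_ℓ - e_p|`. -/
def pureBetti (r i p : ℕ) : ℚ :=
  (Nat.factorial (r - 1) : ℚ) *
    ∏ ℓ ∈ (Finset.range r).erase p, 1 / |(degSeq r i ℓ : ℚ) - (degSeq r i p : ℚ)|

theorem degSeq_strictMono (r i : ℕ) : StrictMono (degSeq r i) := by
  intro a b h
  unfold degSeq
  split_ifs <;> omega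

theorem sign_aux (r i p : ℕ) (hp : p < r) :
    (-1 : ℚ) ^ p * ∏ l ∈ (Finset.range r).erase p,
      1 / |(degSeq r i l : ℚ) - (degSeq r i p : ℚ)| =
    (-1) ^ (r - 1) * (1 / ∏ l ∈ (Finset.range r).erase p,
      ((degSeq r i p : ℚ) - (degSeq r i l : ℚ))) := by
  have h1 : ∀ l ∈ (Finset.range r).erase p,
      1 / |(degSeq r i l : ℚ) - (degSeq r i p : ℚ)| =
      (if l < p then (-1 : ℚ) else 1) *
        (-1 * (1 / ((degSeq r i p : ℚ) - (degSeq r i l : ℚ)))) := by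
    intro l hl
    have hne : l ≠ p := (Finset.mem_erase.1 hl).1
    rcases lt_or_gt_of_ne hne with h | h
    · have h2 : (degSeq r i l : ℚ) < degSeq r i p := by
        exact_mod_cast degSeq_strictMono r i h
      rw [if_pos h, abs_of_neg (by linarith), neg_sub]
      ring
    · have h2 : (degSeq r i p : ℚ) < degSeq r i l := by
        exact_mod_cast degSeq_strictMono r i h
      rw [if_neg (by omega), abs_of_pos (by linarith), ← neg_sub (degSeq r i l : ℚ), one_div_neg_eq_neg_one_div]
      ring
  have hf : ((Finset.range r).erase p).filter (fun l => l < p) = Finset.range p := by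
    ext l
    simp only [Finset.mem_filter, Finset.mem_erase, Finset.mem_range]
    omega
  rw [Finset.prod_congr rfl h1, Finset.prod_mul_distrib, Finset.prod_mul_distrib,
    Finset.prod_ite, hf, Finset.prod_const, Finset.prod_const, Finset.prod_const,
    Finset.card_erase_of_mem (Finset.mem_range.2 hp), Finset.card_range, Finset.card_range,
    one_pow, mul_one, ← mul_assoc, ← mul_pow, Finset.prod_div_distrib]
  simp

/-- `(1 - t)^(r-1)` divides the K-polynomial `Σ_{p=0}^{r-1} (-1)^p β_p t^(e_p)` of the pure
diagram `π_{i,r}` in `ℚ[t]`. -/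
theorem pure_diagram_K_poly_divisible (r i : ℕ) (hr : 2 ≤ r) (hi : i ≤ r - 1) :
    (1 - Polynomial.X : Polynomial ℚ) ^ (r - 1) ∣
      ∑ p ∈ Finset.range r,
        Polynomial.C ((-1 : ℚ) ^ p * pureBetti r i p) * Polynomial.X ^ (degSeq r i p) := by
  have h0 : (1 - Polynomial.X : Polynomial ℚ) = -(Polynomial.X - Polynomial.C 1) := by simp
  rw [h0, neg_pow, IsUnit.mul_left_dvd ((isUnit_one.neg).pow _),
    Polynomial.X_sub_C_pow_dvd_iff, Polynomial.X_pow_dvd_iff]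
  intro k hk
  rw [Polynomial.sum_comp, Polynomial.finsetSum_coeff]
  have hinj : Set.InjOn (fun p => (degSeq r i p : ℚ)) (Finset.range r : Set ℕ) := by
    intro a _ b _ h
    exact (degSeq_strictMono r i).injective (by simpa using h)
  have hnd := descPochhammer_natDegree ℚ k
  have hdeg : (descPochhammer ℚ k).degree < ((Finset.range r).card : ℕ) := by
    refine lt_of_le_of_lt Polynomial.degree_le_natDegree ?_
    rw [hnd, Finset.card_range]
    exact_mod_cast (by omega : k < r)
  have key := Lagrange.coeff_eq_sum hinj hdeg
  rw [Polynomial.coeff_eq_zero_of_natDegree_lt (by rw [hnd, Finset.card_range]; exact hk)] at key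
  have hk0 : (k.factorial : ℚ) ≠ 0 := by exact_mod_cast k.factorial_ne_zero
  have : ∀ p ∈ Finset.range r, ((Polynomial.C ((-1 : ℚ) ^ p * pureBetti r i p) *
      Polynomial.X ^ (degSeq r i p)).comp (Polynomial.X + Polynomial.C 1)).coeff k =
      ((r - 1).factorial * (-1) ^ (r - 1) / k.factorial) *
      ((descPochhammer ℚ k).eval (degSeq r i p : ℚ) / ∏ j ∈ (Finset.range r).erase p,
        ((degSeq r i p : ℚ) - (degSeq r i j : ℚ))) := by
    intro p hp
    have hs := sign_aux r i p (Finset.mem_range.1 hp)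
    rw [Polynomial.mul_comp, Polynomial.C_comp, Polynomial.X_pow_comp, Polynomial.coeff_C_mul,
      Polynomial.C_1, Polynomial.coeff_X_add_one_pow, descPochhammer_eval_eq_descFactorial,
      Nat.descFactorial_eq_factorial_mul_choose, pureBetti, mul_left_comm, hs]
    push_cast
    field_simp
  rw [Finset.sum_congr rfl this, ← Finset.mul_sum, ← key, mul_zero]
end

section
/- Let r ≥ 2 and 0 ≤ i ≤ r−1 be integers, with degree sequence e = e(i,r) and pure diagram entries β_p as above. Then in ℚ[t] one has the polynomial identity Σ_{p=0}^{r−1} (−1)^p · β_p · t^{e_p} = [ (r−i+1)/(r(r+1)) + ((r−1)(r−i+1)/(r(r+1)))·t + (i/(r+1))·t² ] · (1−t)^{r−1}. In other words, the Hilbert numerator of the pure diagram π_{i,r} is (r−i+1)/(r(r+1)) + ((r−1)(r−i+1)/(r(r+1)))·t + (i/(r+1))·t². -/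
open Polynomial in
lemma aux_deriv (n : ℕ) (a : ℕ → ℚ) :
    X * derivative (∑ d ∈ Finset.range n, C (a d) * X ^ d) =
      ∑ d ∈ Finset.range n, C ((d : ℚ) * a d) * X ^ d := by
  rw [derivative_sum, Finset.mul_sum]
  refine Finset.sum_congr rfl fun d _ => ?_
  rcases d with _ | d
  · simp
  · rw [derivative_C_mul_X_pow, Nat.add_sub_cancel, pow_succ, mul_comm (a (d+1))]
    ring

open Polynomial in
lemma aux_sum (s : ℕ) (m : ℚ) :
    ∑ d ∈ Finset.range (s + 3),
      C ((-1 : ℚ) ^ d * ((s + 2).choose d : ℚ) * ((d : ℚ) - 1) * ((d : ℚ) - m)) * X ^ d =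
    (C (((s : ℚ) + 2) * (s + 1)) * X ^ 2 + C (m * (s + 2)) * X * (1 - X) +
      C m * (1 - X) ^ 2) * (1 - X) ^ s := by
  have hA : (1 - X : ℚ[X]) ^ (s + 2) = ∑ d ∈ Finset.range (s + 3),
      C ((-1 : ℚ) ^ d * ((s + 2).choose d : ℚ)) * X ^ d := by
    rw [sub_eq_neg_add, add_pow]
    refine Finset.sum_congr rfl fun d _ => ?_
    rw [neg_pow]
    simp
    ring
  have h1 := aux_deriv (s + 3) (fun d => (-1 : ℚ) ^ d * ((s + 2).choose d : ℚ))
  have h2 := aux_deriv (s + 3) (fun d => (d : ℚ) * ((-1 : ℚ) ^ d * ((s + 2).choose d : ℚ)))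
  rw [← h1] at h2
  rw [← hA] at h1 h2
  have key : ∑ d ∈ Finset.range (s + 3),
      C ((-1 : ℚ) ^ d * ((s + 2).choose d : ℚ) * ((d : ℚ) - 1) * ((d : ℚ) - m)) * X ^ d =
      X * derivative (X * derivative ((1 - X : ℚ[X]) ^ (s + 2)))
      - C (1 + m) * (X * derivative ((1 - X : ℚ[X]) ^ (s + 2))) + C m * (1 - X) ^ (s + 2) := by
    rw [h2, h1, hA, Finset.mul_sum, Finset.mul_sum, ← Finset.sum_sub_distrib,
      ← Finset.sum_add_distrib]
    refine Finset.sum_congr rfl fun d _ => ?_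
    simp only [map_mul, map_sub, map_add, map_one]
    ring
  rw [key]
  simp only [derivative_pow, derivative_mul, derivative_sub, derivative_X, derivative_one,
    Nat.add_sub_cancel, show s + 2 - 1 = s + 1 from rfl, derivative_ofNat, map_zero, map_mul, map_add, map_one,
    Nat.cast_add, derivative_natCast, map_natCast, map_ofNat, Nat.cast_ofNat, Nat.cast_one]
  ring

lemma aux_fact (d s : ℕ) :
    ∏ k ∈ Finset.range (d + 1 + s), (if k = d then (1 : ℚ) else |(k : ℚ) - d|) =
      (d.factorial : ℚ) * s.factorial := by
  induction s with
  | zero =>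
    rw [add_zero, Finset.prod_range_succ, if_pos rfl, ← Finset.prod_range_reflect,
      ← Finset.prod_range_add_one_eq_factorial]
    simp only [mul_one, Nat.factorial_zero, Nat.cast_one]
    push_cast
    refine Finset.prod_congr rfl fun j hj => ?_
    have hj := Finset.mem_range.1 hj
    rw [if_neg (by omega)]
    have : ((d - 1 - j : ℕ) : ℚ) = d - 1 - j := by
      rw [Nat.cast_sub (by omega), Nat.cast_sub (by omega)]; simp
    rw [this, abs_of_nonpos (by have : (0:ℚ) ≤ j := by positivity
                                linarith)]
    ring
  | succ s ih =>
    rw [← add_assoc, Finset.prod_range_succ, ih, if_neg (by omega), Nat.factorial_succ]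
    push_cast
    rw [abs_of_nonneg (by have : (0:ℚ) ≤ s := by positivity
                          linarith)]
    ring

lemma degSeq_inj (r i : ℕ) : Function.Injective (degSeq r i) := by
  intro a b h
  unfold degSeq at h
  split_ifs at h <;> omega

lemma aux_range (s i : ℕ) (hi : i ≤ s) :
    Finset.range (s + 3) =
      insert 1 (insert (s + 2 - i) ((Finset.range (s + 1)).image (degSeq (s + 1) i))) := by
  ext k
  simp only [Finset.mem_range, Finset.mem_insert, Finset.mem_image]
  constructor
  · intro hk
    by_cases h1 : k = 1
    · exact Or.inl h1
    by_cases h2 : k = s + 2 - i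
    · exact Or.inr (Or.inl h2)
    refine Or.inr (Or.inr ?_)
    by_cases h0 : k = 0
    · exact ⟨0, by omega, by simp [degSeq, h0]⟩
    by_cases h3 : k < s + 2 - i
    · refine ⟨k - 1, by omega, ?_⟩
      unfold degSeq
      split_ifs <;> omega
    · refine ⟨k - 2, by omega, ?_⟩
      unfold degSeq
      split_ifs <;> omega
  · rintro (h | h | ⟨p, hp, h⟩)
    · omega
    · omega
    · unfold degSeq at h
      split_ifs at h <;> omega

lemma degSeq_ne_one (r i p : ℕ) : degSeq r i p ≠ 1 := by
  unfold degSeq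
  split_ifs <;> omega

lemma degSeq_ne_m (s i p : ℕ) (hi : i ≤ s) : degSeq (s + 1) i p ≠ s + 2 - i := by
  unfold degSeq
  split_ifs <;> omega

lemma aux_prod {M : Type*} [CommMonoid M] (s i : ℕ) (hi : i ≤ s) (G : ℕ → M) :
    ∏ k ∈ Finset.range (s + 3), G k =
      G 1 * (G (s + 2 - i) * ∏ p ∈ Finset.range (s + 1), G (degSeq (s + 1) i p)) := by
  rw [aux_range s i hi, Finset.prod_insert, Finset.prod_insert,
    Finset.prod_image (fun a _ b _ h => degSeq_inj _ _ h)]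
  · simp only [Finset.mem_image, not_exists, not_and]
    exact fun p _ => degSeq_ne_m s i p hi
  · simp only [Finset.mem_insert, Finset.mem_image, not_or, not_exists, not_and]
    exact ⟨by omega, fun p _ => degSeq_ne_one _ _ p⟩

lemma aux_sign (s i p : ℕ) (hi : i ≤ s) :
    (-1 : ℚ) ^ p * (|(1 : ℚ) - degSeq (s + 1) i p| *
      |((s + 2 - i : ℕ) : ℚ) - degSeq (s + 1) i p|) =
    (-1 : ℚ) ^ (degSeq (s + 1) i p) * ((degSeq (s + 1) i p : ℚ) - 1) *
      ((degSeq (s + 1) i p : ℚ) - (s + 2 - i : ℕ)) := by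
  unfold degSeq
  split_ifs with h0 h1
  · subst h0
    simp
  · have : ((p + 1 : ℕ) : ℚ) ≤ (s + 2 - i : ℕ) := by exact_mod_cast (by omega)
    have h2 : (0 : ℚ) ≤ p := by positivity
    rw [abs_of_nonneg (sub_nonneg.2 this), abs_of_nonpos (by push_cast; linarith), pow_succ]
    ring
  · have : ((s + 2 - i : ℕ) : ℚ) ≤ (p + 2 : ℕ) := by exact_mod_cast (by omega)
    have h2 : (0 : ℚ) ≤ p := by positivity
    rw [abs_of_nonpos (sub_nonpos.2 this), abs_of_nonpos (by push_cast; linarith), pow_add]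
    ring

lemma aux_betti (s i p : ℕ) (hi : i ≤ s) (hp : p < s + 1) :
    (-1 : ℚ) ^ p * pureBetti (s + 1) i p =
      1 / (((s : ℚ) + 2) * (s + 1)) *
      ((-1 : ℚ) ^ (degSeq (s + 1) i p) * ((s + 2).choose (degSeq (s + 1) i p) : ℚ) *
        ((degSeq (s + 1) i p : ℚ) - 1) *
        ((degSeq (s + 1) i p : ℚ) - (s + 2 - i : ℕ))) := by
  have hsign := aux_sign s i p hi
  have hP := aux_prod s i hi
    (fun k => if k = degSeq (s + 1) i p then (1 : ℚ) else |(k : ℚ) - degSeq (s + 1) i p|)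
  have hd : degSeq (s + 1) i p ≤ s + 2 := by
    unfold degSeq
    split_ifs <;> omega
  have hF := aux_fact (degSeq (s + 1) i p) (s + 2 - degSeq (s + 1) i p)
  rw [show degSeq (s + 1) i p + 1 + (s + 2 - degSeq (s + 1) i p) = s + 3 by omega, hP] at hF
  simp only [if_neg (degSeq_ne_one (s + 1) i p).symm, if_neg (degSeq_ne_m s i p hi).symm] at hF
  rw [← Finset.mul_prod_erase _ _ (Finset.mem_range.2 hp), if_pos rfl, one_mul] at hF
  have hE : ∏ x ∈ (Finset.range (s + 1)).erase p,
      (if degSeq (s + 1) i x = degSeq (s + 1) i p then (1 : ℚ)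
        else |(degSeq (s + 1) i x : ℚ) - degSeq (s + 1) i p|) =
      ∏ x ∈ (Finset.range (s + 1)).erase p,
        |(degSeq (s + 1) i x : ℚ) - degSeq (s + 1) i p| := by
    refine Finset.prod_congr rfl fun x hx => if_neg fun h => ?_
    exact (Finset.mem_erase.1 hx).1 (degSeq_inj _ _ h)
  rw [hE] at hF
  have hB : pureBetti (s + 1) i p = (s.factorial : ℚ) /
      ∏ x ∈ (Finset.range (s + 1)).erase p,
        |(degSeq (s + 1) i x : ℚ) - degSeq (s + 1) i p| := by
    unfold pureBetti
    simp [Finset.prod_inv_distrib, div_eq_mul_inv]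
  have hC : ((s + 2).choose (degSeq (s + 1) i p) : ℚ) * ((degSeq (s + 1) i p).factorial *
      (s + 2 - degSeq (s + 1) i p).factorial) = (s + 2) * (s + 1) * s.factorial := by
    have := Nat.choose_mul_factorial_mul_factorial hd
    rw [Nat.factorial_succ, Nat.factorial_succ] at this
    have h' : (((s + 2).choose (degSeq (s + 1) i p) * (degSeq (s + 1) i p).factorial *
      (s + 2 - degSeq (s + 1) i p).factorial : ℕ) : ℚ) = _ := congrArg _ this
    push_cast at h'
    linarith
  rw [hB]
  have hne : ((degSeq (s + 1) i p).factorial : ℚ) *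
      ((s + 2 - degSeq (s + 1) i p).factorial : ℚ) ≠ 0 := by positivity
  rw [← hF] at hC hne
  simp only [Nat.cast_one] at hC hne
  generalize (∏ x ∈ (Finset.range (s + 1)).erase p,
        |(degSeq (s + 1) i x : ℚ) - degSeq (s + 1) i p|) = P at *
  have hPne : P ≠ 0 := fun h => hne (by simp [h])
  have hs : ((s : ℚ) + 2) * (s + 1) ≠ 0 := by positivity
  rw [mul_div_assoc', div_eq_iff hPne, one_div, mul_assoc, inv_mul_eq_div, eq_comm,
    ← eq_comm, eq_div_iff hs]
  linear_combination (-(-1 : ℚ) ^ p) * hC +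
    (((s + 2).choose (degSeq (s + 1) i p) : ℚ) * P) * hsign

/-- The Hilbert numerator of the pure diagram `π_{i,r}` is
`(r-i+1)/(r(r+1)) + ((r-1)(r-i+1)/(r(r+1))) t + (i/(r+1)) t²`, i.e. the K-polynomial
`Σ_{p=0}^{r-1} (-1)^p β_p t^(e_p)` equals this quadratic times `(1 - t)^(r-1)`. -/
theorem pure_diagram_hilbert_numerator (r i : ℕ) (hr : 2 ≤ r) (hi : i ≤ r - 1) :
    ∑ p ∈ Finset.range r,
        Polynomial.C ((-1 : ℚ) ^ p * pureBetti r i p) * Polynomial.X ^ (degSeq r i p) =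
      (Polynomial.C (((r : ℚ) - i + 1) / ((r : ℚ) * ((r : ℚ) + 1))) +
        Polynomial.C (((r : ℚ) - 1) * ((r : ℚ) - i + 1) / ((r : ℚ) * ((r : ℚ) + 1))) *
          Polynomial.X +
        Polynomial.C ((i : ℚ) / ((r : ℚ) + 1)) * Polynomial.X ^ 2) *
        (1 - Polynomial.X : Polynomial ℚ) ^ (r - 1) := by
  obtain ⟨s, rfl⟩ : ∃ s, r = s + 1 := ⟨r - 1, by omega⟩
  rw [Nat.add_sub_cancel] at hi ⊢
  have hm : ((s + 2 - i : ℕ) : ℚ) = s + 2 - i := by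
    rw [Nat.cast_sub (by omega)]; push_cast; ring
  have hS := aux_sum s ((s + 2 - i : ℕ) : ℚ)
  have hQ := aux_prod (M := Multiplicative (Polynomial ℚ)) s i hi
    (fun d => Multiplicative.ofAdd (Polynomial.C ((-1 : ℚ) ^ d * ((s + 2).choose d : ℚ) *
      ((d : ℚ) - 1) * ((d : ℚ) - (s + 2 - i : ℕ))) * Polynomial.X ^ d))
  rw [← ofAdd_sum, ← ofAdd_sum, ← ofAdd_add, ← ofAdd_add] at hQ
  have hQ := Multiplicative.ofAdd.injective hQ
  rw [hS] at hQ
  simp only [Nat.cast_one, sub_self, mul_zero, zero_mul, map_zero, zero_add] at hQ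
  have hL : ∑ p ∈ Finset.range (s + 1), Polynomial.C ((-1 : ℚ) ^ p * pureBetti (s + 1) i p) *
      Polynomial.X ^ (degSeq (s + 1) i p) =
      Polynomial.C (1 / (((s : ℚ) + 2) * (s + 1))) * ∑ p ∈ Finset.range (s + 1),
        Polynomial.C ((-1 : ℚ) ^ (degSeq (s + 1) i p) *
        ((s + 2).choose (degSeq (s + 1) i p) : ℚ) *
        ((degSeq (s + 1) i p : ℚ) - 1) *
        ((degSeq (s + 1) i p : ℚ) - (s + 2 - i : ℕ))) *
        Polynomial.X ^ (degSeq (s + 1) i p) := by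
    rw [Finset.mul_sum]
    refine Finset.sum_congr rfl fun p hp => ?_
    rw [aux_betti s i p hi (Finset.mem_range.1 hp), Polynomial.C_mul, mul_assoc]
  rw [hL, ← hQ, hm, ← mul_assoc]
  congr 1
  have hs1 : (s : ℚ) + 1 ≠ 0 := by positivity
  have hs2 : (s : ℚ) + 2 ≠ 0 := by positivity
  have hs3 : (s : ℚ) + 1 + 1 ≠ 0 := by positivity
  have e0 : ((s + 1 : ℕ) - i + 1 : ℚ) / ((s + 1 : ℕ) * ((s + 1 : ℕ) + 1)) =
      1 / (((s : ℚ) + 2) * (s + 1)) * (s + 2 - i) := by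
    push_cast; field_simp; ring
  have e1 : ((s + 1 : ℕ) - 1 : ℚ) * ((s + 1 : ℕ) - i + 1) / ((s + 1 : ℕ) * ((s + 1 : ℕ) + 1)) =
      1 / (((s : ℚ) + 2) * (s + 1)) * ((s + 2 - i) * (s + 2) - 2 * (s + 2 - i)) := by
    push_cast; field_simp; ring
  have e2 : (i : ℚ) / ((s + 1 : ℕ) + 1) =
      1 / (((s : ℚ) + 2) * (s + 1)) *
        ((s + 2) * (s + 1) - (s + 2 - i) * (s + 2) + (s + 2 - i)) := by
    push_cast; field_simp; ring
  rw [e0, e1, e2]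
  generalize 1 / (((s : ℚ) + 2) * (s + 1)) = c
  simp only [map_mul, map_add, map_sub, map_ofNat]
  ring
end

section
/- Let r ≥ 2 and 0 ≤ i ≤ r−1 be integers, with degree sequence e = e(i,r) and pure diagram entries β_p as above. If h ∈ ℚ[t] is a polynomial satisfying Σ_{p=0}^{r−1} (−1)^p · β_p · t^{e_p} = h(t)·(1−t)^{r−1}, then h(1) = 1. (That is, the pure diagram π_{i,r} has multiplicity 1.) -/
theorem degSeq_lt (r i : ℕ) {a b : ℕ} (hab : a < b) : degSeq r i a < degSeq r i b := by
  unfold degSeq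
  split_ifs <;> omega

theorem sign_prod (r p : ℕ) (hp : p < r) :
    ∏ l ∈ (Finset.range r).erase p, (if l < p then (1 : ℚ) else -1) = (-1) ^ (r - 1 - p) := by
  rw [Finset.prod_ite]
  simp only [Finset.prod_const, one_pow, one_mul]
  congr 1
  have : ((Finset.range r).erase p).filter (fun l => ¬ l < p) = Finset.Ioo p r := by
    ext l
    simp only [Finset.mem_filter, Finset.mem_erase, Finset.mem_range, Finset.mem_Ioo]
    omega
  rw [this, Nat.card_Ioo]
  omega

theorem signed_betti (r i p : ℕ) (hp : p < r) :
    (-1 : ℚ) ^ p * pureBetti r i p = (-1) ^ (r - 1) * ((Nat.factorial (r - 1) : ℚ) /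
      ∏ l ∈ (Finset.range r).erase p, ((degSeq r i p : ℚ) - (degSeq r i l : ℚ))) := by
  have h1 : ∏ l ∈ (Finset.range r).erase p, ((degSeq r i p : ℚ) - (degSeq r i l : ℚ)) =
      (-1) ^ (r - 1 - p) *
        ∏ l ∈ (Finset.range r).erase p, |(degSeq r i l : ℚ) - (degSeq r i p : ℚ)| := by
    rw [← sign_prod r p hp, ← Finset.prod_mul_distrib]
    refine Finset.prod_congr rfl fun l hl => ?_
    have hne := (Finset.mem_erase.mp hl).1
    rcases lt_or_gt_of_ne hne with h | h
    · have := degSeq_lt r i h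
      have h' : (degSeq r i l : ℚ) < degSeq r i p := by exact_mod_cast this
      rw [if_pos h, abs_of_neg (by linarith)]; ring
    · have := degSeq_lt r i h
      have h' : (degSeq r i p : ℚ) < degSeq r i l := by exact_mod_cast this
      rw [if_neg (by omega), abs_of_pos (by linarith)]; ring
  have h2 : (-1 : ℚ) ^ (r - 1) = (-1) ^ p * (-1) ^ (r - 1 - p) := by
    rw [← pow_add]; congr 1; omega
  rw [h1, h2, pureBetti]
  simp only [one_div, Finset.prod_inv_distrib]
  rcases neg_one_pow_eq_or ℚ (r - 1 - p) with h | h <;> rw [h] <;> 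
    simp [div_eq_mul_inv, inv_neg]

theorem pure_diagram_multiplicity_one (r i : ℕ) (hr : 2 ≤ r) (hi : i ≤ r - 1)
    (h : Polynomial ℚ)
    (hh : ∑ p ∈ Finset.range r,
        Polynomial.C ((-1 : ℚ) ^ p * pureBetti r i p) * Polynomial.X ^ (degSeq r i p) =
      h * (1 - Polynomial.X : Polynomial ℚ) ^ (r - 1)) :
    h.eval 1 = 1 := by
  have hL := Lagrange.leadingCoeff_eq_sum (s := Finset.range r)
    (v := fun p => (degSeq r i p : ℚ)) (P := descPochhammer ℚ (r - 1))
    (by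
      intro a _ b _ hab
      have hab' : degSeq r i a = degSeq r i b := by
        simpa using hab
      rcases lt_trichotomy a b with h | h | h
      · have := degSeq_lt r i h; omega
      · exact h
      · have := degSeq_lt r i h; omega)
    (by
      rw [Polynomial.degree_eq_natDegree (monic_descPochhammer ℚ _).ne_zero,
        descPochhammer_natDegree, Finset.card_range]
      norm_cast; omega)
  rw [(monic_descPochhammer ℚ _).leadingCoeff] at hL
  have hT := congrArg (fun q => (Polynomial.taylor (1 : ℚ) q).coeff (r - 1)) hh
  have hR : (Polynomial.taylor (1 : ℚ) (h * (1 - Polynomial.X) ^ (r - 1))).coeff (r - 1) =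
      (-1) ^ (r - 1) * h.eval 1 := by
    have : Polynomial.taylor (1 : ℚ) (h * (1 - Polynomial.X) ^ (r - 1)) =
        Polynomial.C ((-1) ^ (r - 1)) * Polynomial.taylor 1 h * Polynomial.X ^ (r - 1) := by
      rw [Polynomial.taylor_mul, Polynomial.taylor_pow, map_sub, Polynomial.taylor_X,
        Polynomial.taylor_one, map_pow, map_neg, map_one]
      rw [show (1 - (Polynomial.X + 1) : Polynomial ℚ) = (-1) * Polynomial.X by ring, mul_pow]
      ring
    rw [this, Polynomial.coeff_mul_X_pow', if_pos le_rfl, Nat.sub_self, Polynomial.coeff_C_mul,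
      Polynomial.taylor_coeff_zero]
  simp only [hR] at hT
  rw [map_sum, Polynomial.finsetSum_coeff] at hT
  have hS : ∀ p ∈ Finset.range r, (Polynomial.taylor (1 : ℚ)
      (Polynomial.C ((-1 : ℚ) ^ p * pureBetti r i p) * Polynomial.X ^ (degSeq r i p))).coeff (r - 1)
      = (-1) ^ (r - 1) * ((descPochhammer ℚ (r - 1)).eval (degSeq r i p : ℚ) /
        ∏ l ∈ (Finset.range r).erase p, ((degSeq r i p : ℚ) - (degSeq r i l : ℚ))) := by
    intro p hp
    rw [Polynomial.taylor_mul, Polynomial.taylor_C, Polynomial.coeff_C_mul,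
      Polynomial.taylor_X_pow, map_one, add_comm, Polynomial.coeff_one_add_X_pow,
      signed_betti r i p (Finset.mem_range.mp hp), descPochhammer_eval_eq_descFactorial,
      Nat.descFactorial_eq_factorial_mul_choose]
    push_cast
    ring
  rw [Finset.sum_congr rfl hS, ← Finset.mul_sum, ← hL] at hT
  exact (mul_left_cancel₀ (pow_ne_zero _ (by norm_num)) hT).symm
end

section
/- Let g be a natural number, let r : ℕ → ℕ be a sequence with r(d) ≥ g+1 for all d and r(d) → ∞ as d → ∞, and for each d let c_d : {0,1,…,g} → ℚ satisfy c_d(i) ≥ 0 for all i, Σ_{i=0}^{g} c_d(i) = 1, and the equation Σ_{i=0}^{g} c_d(i)·(i/(r(d)+1)) = g/(r(d)+g). Then c_d(g) → 1 as d → ∞, and for every i ≠ g, c_d(i) → 0 as d → ∞. (This is the numerical core of the main theorem: the rescaled Betti table of a genus-g curve of degree r(d)+g converges to the single pure diagram π_{g,r(d)}, since matching the t² coefficients of Hilbert numerators in the Boij–Söderberg decomposition yields exactly the displayed equation.) -/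
open Filter

/-- Numerical core of the main theorem: if `r d ≥ g + 1`, `r d → ∞`, and the nonnegative
rationals `c_d(0), …, c_d(g)` sum to `1` and satisfy
`Σ_i c_d(i) · (i / (r d + 1)) = g / (r d + g)` (matching of `t²` coefficients of Hilbert
numerators in the Boij–Söderberg decomposition), then `c_d(g) → 1` and `c_d(i) → 0` for
`i ≠ g`. -/
theorem asymptotic_boij_soederberg_coeffs (g : ℕ) (r : ℕ → ℕ) (c : ℕ → Fin (g + 1) → ℚ)
    (hr : ∀ d, g + 1 ≤ r d)
    (hrlim : Tendsto r atTop atTop)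
    (hnonneg : ∀ d i, 0 ≤ c d i)
    (hsum : ∀ d, ∑ i, c d i = 1)
    (heq : ∀ d, ∑ i : Fin (g + 1), c d i * ((i : ℕ) / ((r d : ℚ) + 1)) =
      (g : ℚ) / ((r d : ℚ) + g)) :
    Tendsto (fun d => ((c d (Fin.last g) : ℚ) : ℝ)) atTop (nhds 1) ∧
      ∀ i : Fin (g + 1), i ≠ Fin.last g →
        Tendsto (fun d => ((c d i : ℚ) : ℝ)) atTop (nhds 0) := by
  have key : ∀ d, ∑ i : Fin (g + 1), c d i * ((g : ℚ) - (i : ℕ)) =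
      (g : ℚ) * (g - 1) / ((r d : ℚ) + g) := by
    intro d
    have h1 : (0 : ℚ) < (r d : ℚ) + 1 := by positivity
    have h2 : (0 : ℚ) < (r d : ℚ) + g := by
      have h3 : 0 < r d := by have := hr d; omega
      positivity
    have e1 : ∑ i : Fin (g + 1), c d i * ((g : ℚ) - (i : ℕ)) =
        g * ∑ i, c d i - (r d + 1) *
          ∑ i : Fin (g + 1), c d i * ((i : ℕ) / ((r d : ℚ) + 1)) := by
      rw [Finset.mul_sum, Finset.mul_sum, ← Finset.sum_sub_distrib]
      refine Finset.sum_congr rfl fun i _ => ?_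
      field_simp
    rw [e1, hsum, heq]
    field_simp
    ring
  have bound : ∀ d (i : Fin (g + 1)), i ≠ Fin.last g →
      c d i ≤ (g : ℚ) * (g - 1) / ((r d : ℚ) + g) := by
    intro d i hi
    rw [← key d]
    have hlt : (i : ℕ) + 1 ≤ g := by
      have := Fin.val_lt_last hi
      omega
    have hlt' : ((i : ℕ) : ℚ) + 1 ≤ g := by exact_mod_cast hlt
    have h1 : c d i ≤ c d i * ((g : ℚ) - (i : ℕ)) :=
      le_mul_of_one_le_right (hnonneg d i) (by linarith)
    refine h1.trans (Finset.single_le_sum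
      (f := fun i : Fin (g + 1) => c d i * ((g : ℚ) - (i : ℕ))) ?_ (Finset.mem_univ i))
    intro j _
    have hj : (j : ℕ) ≤ g := by omega
    have hj' : ((j : ℕ) : ℚ) ≤ g := by exact_mod_cast hj
    exact mul_nonneg (hnonneg d j) (by linarith)
  have hlim : Tendsto (fun d => (g : ℝ) * (g - 1) / ((r d : ℝ) + g)) atTop (nhds 0) :=
    Tendsto.const_div_atTop (tendsto_atTop_add_const_right _ _
      (tendsto_natCast_atTop_atTop.comp hrlim)) _
  have hzero : ∀ i : Fin (g + 1), i ≠ Fin.last g →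
      Tendsto (fun d => ((c d i : ℚ) : ℝ)) atTop (nhds 0) := by
    intro i hi
    refine squeeze_zero (fun d => by exact_mod_cast hnonneg d i) (fun d => ?_) hlim
    have := bound d i hi
    exact_mod_cast this
  refine ⟨?_, hzero⟩
  have hl : (fun d => ((c d (Fin.last g) : ℚ) : ℝ)) =
      fun d => 1 - ∑ i : Fin g, ((c d i.castSucc : ℚ) : ℝ) := by
    funext d
    have h := hsum d
    rw [Fin.sum_univ_castSucc] at h
    have h' : c d (Fin.last g) = 1 - ∑ i : Fin g, c d i.castSucc := by linarith
    rw [h']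
    push_cast
    rfl
  rw [hl]
  have hs : Tendsto (fun d => ∑ i : Fin g, ((c d i.castSucc : ℚ) : ℝ)) atTop
      (nhds (∑ _i : Fin g, (0 : ℝ))) :=
    tendsto_finsetSum _ fun i _ => hzero _ (Fin.castSucc_lt_last i).ne
  simpa using hs.const_sub 1
end

section
/- Let g be a natural number, let r : ℕ → ℕ be a sequence with r(d) ≥ g+1 for all d and r(d) → ∞ as d → ∞, and for each d let c_d : {0,1,…,g} → ℚ satisfy c_d(i) ≥ 0 for all i and the polynomial identity in ℚ[t]: Σ_{i=0}^{g} c_d(i)·[ (r(d)−i+1)/(r(d)(r(d)+1)) + ((r(d)−1)(r(d)−i+1)/(r(d)(r(d)+1)))·t + (i/(r(d)+1))·t² ] = (1/(r(d)+g)) + ((r(d)−1)/(r(d)+g))·t + (g/(r(d)+g))·t². Then c_d(g) → 1 as d → ∞, and for every i ≠ g, c_d(i) → 0 as d → ∞. -/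
open Filter Polynomial

/-- If `r d ≥ g + 1`, `r d → ∞`, and the nonnegative rationals `c_d(0), …, c_d(g)` satisfy the
polynomial identity in `ℚ[t]` expressing that the Hilbert numerator of the rescaled Betti table
of a genus-`g` curve is the corresponding combination of the Hilbert numerators of the pure
diagrams `π_{i, r d}`, then `c_d(g) → 1` and `c_d(i) → 0` for `i ≠ g`. -/
theorem asymptotic_boij_soederberg_from_hilbert_numerators (g : ℕ) (r : ℕ → ℕ)
    (c : ℕ → Fin (g + 1) → ℚ)
    (hr : ∀ d, g + 1 ≤ r d)
    (hrlim : Tendsto r atTop atTop)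
    (hnonneg : ∀ d i, 0 ≤ c d i)
    (heq : ∀ d, ∑ i : Fin (g + 1), C (c d i) *
        (C (((r d : ℚ) - (i : ℕ) + 1) / ((r d : ℚ) * ((r d : ℚ) + 1))) +
          C (((r d : ℚ) - 1) * ((r d : ℚ) - (i : ℕ) + 1) / ((r d : ℚ) * ((r d : ℚ) + 1))) * X +
          C (((i : ℕ) : ℚ) / ((r d : ℚ) + 1)) * X ^ 2) =
      C (1 / ((r d : ℚ) + g)) + C (((r d : ℚ) - 1) / ((r d : ℚ) + g)) * X +
        C ((g : ℚ) / ((r d : ℚ) + g)) * X ^ 2) :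
    Tendsto (fun d => ((c d (Fin.last g) : ℚ) : ℝ)) atTop (nhds 1) ∧
      ∀ i : Fin (g + 1), i ≠ Fin.last g →
        Tendsto (fun d => ((c d i : ℚ) : ℝ)) atTop (nhds 0) := by
  have hRpos : ∀ d, (0 : ℚ) < r d := fun d => by
    have := hr d
    exact_mod_cast (by omega : 0 < r d)
  have h1 : ∀ d, ∑ i : Fin (g + 1), c d i = 1 := by
    intro d
    have h := congrArg (Polynomial.eval 1) (heq d)
    have hp := hRpos d
    have hg : (0 : ℚ) ≤ g := Nat.cast_nonneg g
    simp only [eval_finset_sum, eval_mul, eval_add, eval_C, eval_X, eval_pow] at h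
    have e : ((1 : ℚ) / ((r d : ℚ) + g) + (((r d : ℚ) - 1) / ((r d : ℚ) + g)) * 1 +
        ((g : ℚ) / ((r d : ℚ) + g)) * 1 ^ 2) = 1 := by
      have : (r d : ℚ) + g ≠ 0 := by positivity
      field_simp
      ring
    rw [e] at h
    rw [← h]
    refine Finset.sum_congr rfl fun i _ => ?_
    have : (r d : ℚ) + 1 ≠ 0 := by positivity
    field_simp
    ring
  have h2 : ∀ d, ∑ i : Fin (g + 1), c d i * ((r d : ℚ) - (i : ℕ) + 1)
      = (r d : ℚ) * (r d + 1) / (r d + g) := by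
    intro d
    have h := congrArg (Polynomial.eval 0) (heq d)
    have hp := hRpos d
    have hg : (0 : ℚ) ≤ g := Nat.cast_nonneg g
    simp only [eval_finset_sum, eval_mul, eval_add, eval_C, eval_X, eval_pow] at h
    have e : (r d : ℚ) * (r d + 1) / (r d + g) = (r d : ℚ) * (r d + 1) *
      ((1 : ℚ) / ((r d : ℚ) + g) + (((r d : ℚ) - 1) / ((r d : ℚ) + g)) * 0 +
        ((g : ℚ) / ((r d : ℚ) + g)) * 0 ^ 2) := by ring
    rw [e, ← h, Finset.mul_sum]
    refine Finset.sum_congr rfl fun i _ => ?_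
    have : (r d : ℚ) + 1 ≠ 0 := by positivity
    field_simp
    ring
  have h3 : ∀ d, ∑ i : Fin (g + 1), c d i * ((g : ℚ) - (i : ℕ))
      = (g : ℚ) * (g - 1) / (r d + g) := by
    intro d
    have hp := hRpos d
    have : (r d : ℚ) + g ≠ 0 := by positivity
    have e : ∑ i : Fin (g + 1), c d i * ((g : ℚ) - (i : ℕ)) =
        ∑ i : Fin (g + 1), c d i * ((r d : ℚ) - (i : ℕ) + 1) +
        ((g : ℚ) - r d - 1) * ∑ i : Fin (g + 1), c d i := by
      rw [Finset.mul_sum, ← Finset.sum_add_distrib]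
      exact Finset.sum_congr rfl fun i _ => by ring
    rw [e, h1, h2]
    field_simp
    ring
  have h4 : ∀ d, ∀ i : Fin (g + 1), i ≠ Fin.last g →
      c d i ≤ (g : ℚ) * (g - 1) / (r d + g) := by
    intro d i hi
    have hlt : (i : ℕ) + 1 ≤ g := by
      have := Fin.val_lt_last hi
      omega
    have hlt' : ((i : ℕ) : ℚ) + 1 ≤ g := by exact_mod_cast hlt
    rw [← h3 d]
    have hs := Finset.single_le_sum (f := fun i : Fin (g + 1) => c d i * ((g : ℚ) - (i : ℕ)))
      (fun j _ => mul_nonneg (hnonneg d j) (by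
        have : ((j : ℕ) : ℚ) ≤ g := by exact_mod_cast Nat.lt_succ_iff.mp j.2
        linarith)) (Finset.mem_univ i)
    refine le_trans ?_ hs
    have := hnonneg d i
    show c d i ≤ c d i * ((g : ℚ) - (i : ℕ))
    nlinarith
  have hb : Tendsto (fun d => (g : ℝ) * (g - 1) / ((r d : ℝ) + g)) atTop (nhds 0) := by
    apply Tendsto.const_div_atTop
    exact tendsto_atTop_add_const_right _ _ (tendsto_natCast_atTop_atTop.comp hrlim)
  have h5 : ∀ i : Fin (g + 1), i ≠ Fin.last g →
        Tendsto (fun d => ((c d i : ℚ) : ℝ)) atTop (nhds 0) := by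
    intro i hi
    refine squeeze_zero (fun d => by exact_mod_cast hnonneg d i) (fun d => ?_) hb
    have := h4 d i hi
    have h' : ((c d i : ℚ) : ℝ) ≤ (((g : ℚ) * (g - 1) / (r d + g) : ℚ) : ℝ) := by
      exact_mod_cast this
    push_cast at h'
    exact h'
  refine ⟨?_, h5⟩
  have h6 : ∀ d, ((c d (Fin.last g) : ℚ) : ℝ) = 1 - ∑ i : Fin g, ((c d i.castSucc : ℚ) : ℝ) := by
    intro d
    have h := h1 d
    rw [Fin.sum_univ_castSucc] at h
    have h' := congrArg (fun q : ℚ => (q : ℝ)) h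
    push_cast at h'
    linarith
  simp_rw [h6]
  have h7 : Tendsto (fun d => ∑ i : Fin g, ((c d i.castSucc : ℚ) : ℝ)) atTop
      (nhds (∑ _i : Fin g, (0 : ℝ))) :=
    tendsto_finset_sum _ fun i _ => h5 _ (Fin.castSucc_lt_last i).ne
  simpa using h7.const_sub 1
end
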